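/- arXiv:2403.07604 — 11 statements merged into one kernel-verified Lean document; each statement's English description precedes it below -/
import Mathlib

section
/- Let N, M, ℓ be positive integers with 1 ≤ M < N, let 0 < ε < 1 be real, and suppose 2^ℓ ≥ 4M and 2^(ℓ-1) ≥ ln(√(8πM)/ε). Set p = M/N and S = Σ_{e ∈ {0,...,N}, e ≡ M (mod 2^ℓ)} C(N,e)·p^e·(1-p)^(N-e). Then S ≥ 1/√(8πM) and C(N,M)·p^M·(1-p)^(N-M) / S ≥ 1 - ε. (In the protocol, S is the success probability and the ratio is the squared fidelity |⟨W_N(M)|Ψ^(ℓ)⟩|² of the prepared state with the Dicke state.) -/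
open Real Finset

theorem factorial_le_exp_mul_sqrt_mul_pow {n : ℕ} (hn : n ≠ 0) :
    (n.factorial : ℝ) ≤ exp 1 * √n * (n / exp 1) ^ n := by
  obtain ⟨k, rfl⟩ := Nat.exists_eq_succ_of_ne_zero hn
  have h := Stirling.stirlingSeq'_antitone (Nat.zero_le k)
  simp only [Function.comp_apply, Nat.succ_eq_add_one, zero_add, Stirling.stirlingSeq_one] at h
  have hk : (0 : ℝ) < ((k + 1 : ℕ) : ℝ) := by positivity
  rw [Stirling.stirlingSeq, div_le_iff₀ (by positivity),
    Real.sqrt_mul (by norm_num : (0 : ℝ) ≤ 2)] at h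
  have h2 : √(2 : ℝ) ≠ 0 := by positivity
  calc _ ≤ _ := h
    _ = _ := by field_simp

theorem one_div_sqrt_le_binomial_at_mean {N M : ℕ} (hM : 1 ≤ M) (hMN : M < N) :
    1 / √(8 * π * M) ≤
      (N.choose M : ℝ) * ((M : ℝ) / N) ^ M * (1 - (M : ℝ) / N) ^ (N - M) := by
  obtain ⟨K, rfl⟩ := Nat.exists_eq_add_of_lt hMN
  rw [add_assoc]
  set K' := K + 1 with hK'
  have hK0 : K' ≠ 0 := by omega
  have hM0 : M ≠ 0 := by omega
  have hMp : (0 : ℝ) < M := by positivity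
  have hKp : (0 : ℝ) < K' := by positivity
  have hN : (0 : ℝ) < ((M + K' : ℕ) : ℝ) := by positivity
  have hq : 1 - (M : ℝ) / ((M + K' : ℕ) : ℝ) = K' / ((M + K' : ℕ) : ℝ) := by
    field_simp
    push_cast
    ring
  rw [hq, Nat.add_sub_cancel_left, Nat.cast_add_choose]
  set n : ℝ := ((M + K' : ℕ) : ℝ) with hn
  have e0 := exp_pos 1
  have hlow := Stirling.le_factorial_stirling (M + K')
  rw [← hn] at hlow
  have hbM := factorial_le_exp_mul_sqrt_mul_pow hM0
  have hbK := factorial_le_exp_mul_sqrt_mul_pow hK0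
  have hsq : exp 1 ^ 2 * √(K' : ℝ) * √(M : ℝ) ≤ √(2 * π * n) * √(8 * π * M) := by
    have h1 : √(2 * π * n) * √(8 * π * M) = 4 * π * √n * √M := by
      rw [← Real.sqrt_mul (by positivity),
        show 2 * π * n * (8 * π * M) = (4 * π) ^ 2 * (n * M) by ring,
        Real.sqrt_mul (by positivity), Real.sqrt_sq (by positivity), Real.sqrt_mul hN.le]
      ring
    rw [h1]
    have h2 : exp 1 ^ 2 ≤ 4 * π := by
      nlinarith [Real.exp_one_lt_d9, Real.pi_gt_three]
    have h3 : √(K' : ℝ) ≤ √n := by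
      apply Real.sqrt_le_sqrt
      rw [hn]
      push_cast
      linarith
    gcongr
  rw [div_le_iff₀ (by positivity)]
  have hprod : (M.factorial : ℝ) * K'.factorial ≤
      (exp 1 * √M * (M / exp 1) ^ M) * (exp 1 * √K' * (K' / exp 1) ^ K') := by
    gcongr
  have hpow : (M / exp 1) ^ M * (K' / exp 1) ^ K' =
      (n / exp 1) ^ (M + K') * ((M / n) ^ M * (K' / n) ^ K') := by
    simp only [div_pow, pow_add]
    field_simp
  have key : (M.factorial : ℝ) * K'.factorial ≤
      ((M + K').factorial : ℝ) * ((M / n) ^ M * (K' / n) ^ K') * √(8 * π * M) := by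
    calc _ ≤ _ := hprod
      _ = (exp 1 ^ 2 * √(K' : ℝ) * √(M : ℝ)) * ((M / exp 1) ^ M * (K' / exp 1) ^ K') := by ring
      _ ≤ (√(2 * π * n) * √(8 * π * M)) * ((M / exp 1) ^ M * (K' / exp 1) ^ K') := by gcongr
      _ = (√(2 * π * n) * (n / exp 1) ^ (M + K')) * ((M / n) ^ M * (K' / n) ^ K') *
            √(8 * π * M) := by
        rw [hpow]
        ring
      _ ≤ _ := by gcongr
  have hf : (0 : ℝ) < (M.factorial : ℝ) * K'.factorial := by positivity
  calc (1 : ℝ) ≤ _ := (one_le_div hf).2 key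
    _ = _ := by ring

theorem binomial_tail_sum_le {N a : ℕ} {p : ℝ} (hp0 : 0 ≤ p) (hp1 : p ≤ 1) (s : Finset ℕ)
    (hs : s ⊆ range (N + 1)) (ha : ∀ e ∈ s, a ≤ e) :
    ∑ e ∈ s, (N.choose e : ℝ) * p ^ e * (1 - p) ^ (N - e) ≤
      exp (N * p * (exp 1 - 1) - a) := by
  have hq : 0 ≤ 1 - p := by linarith
  calc ∑ e ∈ s, (N.choose e : ℝ) * p ^ e * (1 - p) ^ (N - e)
      ≤ ∑ e ∈ s, exp (-a) * ((p * exp 1) ^ e * (1 - p) ^ (N - e) * N.choose e) := by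
        refine sum_le_sum fun e he => ?_
        have h1 : (1 : ℝ) ≤ exp (-a) * exp 1 ^ e := by
          rw [← Real.exp_nat_mul, ← Real.exp_add]
          apply Real.one_le_exp
          have : (a : ℝ) ≤ e := mod_cast ha e he
          linarith
        calc _ ≤ (exp (-a) * exp 1 ^ e) * ((N.choose e : ℝ) * p ^ e * (1 - p) ^ (N - e)) :=
              le_mul_of_one_le_left (by positivity) h1
          _ = _ := by ring
    _ ≤ ∑ e ∈ range (N + 1), exp (-a) * ((p * exp 1) ^ e * (1 - p) ^ (N - e) * N.choose e) :=
        sum_le_sum_of_subset_of_nonneg hs fun _ _ _ => by positivity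
    _ = exp (-a) * (p * exp 1 + (1 - p)) ^ N := by rw [← mul_sum, ← add_pow]
    _ ≤ exp (-a) * exp (p * (exp 1 - 1)) ^ N := by
        gcongr
        have := Real.add_one_le_exp (p * (exp 1 - 1))
        linarith
    _ = _ := by
        rw [← Real.exp_nat_mul, ← Real.exp_add]
        ring_nf

theorem dicke_preparation_success_and_fidelity
    (N M ℓ : ℕ) (hM : 1 ≤ M) (hMN : M < N) (hℓ : 1 ≤ ℓ)
    (ε : ℝ) (hε0 : 0 < ε) (hε1 : ε < 1)
    (h2ℓ : (2 : ℝ) ^ ℓ ≥ 4 * M)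
    (h2ℓ' : (2 : ℝ) ^ (ℓ - 1) ≥ Real.log (Real.sqrt (8 * π * M) / ε))
    (p : ℝ) (hp : p = (M : ℝ) / N)
    (S : ℝ)
    (hS : S = ∑ e ∈ Finset.range (N + 1),
        if e % 2 ^ ℓ = M % 2 ^ ℓ then
          (N.choose e : ℝ) * p ^ e * (1 - p) ^ (N - e) else 0) :
    S ≥ 1 / Real.sqrt (8 * π * M) ∧
      (N.choose M : ℝ) * p ^ M * (1 - p) ^ (N - M) / S ≥ 1 - ε := by
  have hb := one_div_sqrt_le_binomial_at_mean hM hMN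
  rw [← hp] at hb
  have hMp : (0 : ℝ) < M := by positivity
  have hMN' : (M : ℝ) < N := mod_cast hMN
  have hNp : (0 : ℝ) < N := hMp.trans hMN'
  have hp0 : 0 ≤ p := by rw [hp]; positivity
  have hp1 : p ≤ 1 := by rw [hp, div_le_one hNp]; exact hMN'.le
  have hq : 0 ≤ 1 - p := by linarith
  have hNpM : (N : ℝ) * p = M := by rw [hp]; field_simp
  have hMmem : M ∈ (range (N + 1)).filter (fun e => e % 2 ^ ℓ = M % 2 ^ ℓ) := by
    simp; omega
  rw [← sum_filter, ← add_sum_erase _ _ hMmem] at hS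
  set T := ∑ e ∈ ((range (N + 1)).filter (fun e => e % 2 ^ ℓ = M % 2 ^ ℓ)).erase M,
    (N.choose e : ℝ) * p ^ e * (1 - p) ^ (N - e) with hT
  set b := (N.choose M : ℝ) * p ^ M * (1 - p) ^ (N - M)
  have hT0 : 0 ≤ T := sum_nonneg fun _ _ => by positivity
  have hr : 0 < 1 / √(8 * π * M) := by positivity
  have hL : 4 * M ≤ 2 ^ ℓ := mod_cast h2ℓ
  have hTexp : T ≤ exp (N * p * (exp 1 - 1) - (M + 2 ^ ℓ : ℕ)) := by
    refine binomial_tail_sum_le hp0 hp1 _ ((erase_subset _ _).trans (filter_subset _ _)) ?_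
    intro e he
    simp only [mem_erase, mem_filter] at he
    obtain ⟨hne, -, hmod⟩ := he
    rw [Nat.mod_eq_of_lt (by omega : M < 2 ^ ℓ)] at hmod
    have hdiv := Nat.mod_add_div e (2 ^ ℓ)
    rw [hmod] at hdiv
    have : 0 < e / 2 ^ ℓ := by
      by_contra! h0
      rw [Nat.le_zero.1 h0] at hdiv
      omega
    nlinarith [Nat.le_mul_of_pos_right (2 ^ ℓ) this]
  have hTε : T ≤ ε * b := by
    have hhalf : (2 : ℝ) ^ ℓ = 2 * 2 ^ (ℓ - 1) := by
      rw [← pow_succ', Nat.sub_add_cancel hℓ]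
    calc T ≤ _ := hTexp
      _ ≤ exp (-Real.log (√(8 * π * M) / ε)) := by
        apply Real.exp_le_exp.2
        rw [hNpM]
        push_cast
        nlinarith [Real.exp_one_lt_d9]
      _ = ε * (1 / √(8 * π * M)) := by
        rw [Real.exp_neg, Real.exp_log (by positivity)]
        field_simp
      _ ≤ ε * b := by gcongr
  refine ⟨by linarith, ?_⟩
  rw [ge_iff_le, le_div_iff₀ (by linarith), hS]
  nlinarith [mul_nonneg hε0.le hT0]
end

section
/- Let N, M, ℓ be positive integers with 1 ≤ M < N and 2^ℓ ≥ 4M, and set p = M/N. Then C(N,M)·p^M·(1-p)^(N-M) / [Σ_{e ∈ {0,...,N}, e ≡ M (mod 2^ℓ)} C(N,e)·p^e·(1-p)^(N-e)] ≥ 1 - √(8πM)·e^{-2^(ℓ-1)}. -/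
open Real Finset

/-- Beyond its mean `M`, the binomial weight with success probability `M / N` decays at least as
fast as the Poisson weight with the same mean. -/
lemma binomial_weight_succ_le {N M : ℕ} (hMN : M < N) (i : ℕ) :
    ((M : ℝ) + i + 1) * ((N.choose (M + i + 1) : ℝ) * ((M : ℝ) / N) ^ (M + i + 1) *
        (1 - (M : ℝ) / N) ^ (N - (M + i + 1))) ≤
      M * ((N.choose (M + i) : ℝ) * ((M : ℝ) / N) ^ (M + i) *
        (1 - (M : ℝ) / N) ^ (N - (M + i))) := by
  have hN : (0 : ℝ) < N := by exact_mod_cast (by omega : 0 < N)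
  have hMN' : (M : ℝ) < N := by exact_mod_cast hMN
  have hp : (0 : ℝ) ≤ (M : ℝ) / N := by positivity
  have hq : (0 : ℝ) < 1 - (M : ℝ) / N := by
    rw [sub_pos, div_lt_one hN]; exact hMN'
  rcases Nat.lt_or_ge (M + i) N with h | h
  · have hc : (N.choose (M + i + 1) : ℝ) * ((M : ℝ) + i + 1) =
        N.choose (M + i) * ((N : ℝ) - M - i) := by
      have := Nat.choose_succ_right_eq N (M + i)
      have h2 : ((N - (M + i) : ℕ) : ℝ) = (N : ℝ) - M - i := by
        rw [Nat.cast_sub h.le]; push_cast; ring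
      rw [← h2]
      exact_mod_cast this
    have he : N - (M + i) = N - (M + i + 1) + 1 := by omega
    rw [he, pow_succ (1 - (M : ℝ) / N), pow_succ ((M : ℝ) / N)]
    set A := ((M : ℝ) / N) ^ (M + i)
    set B := (1 - (M : ℝ) / N) ^ (N - (M + i + 1))
    have hAB : 0 ≤ (N.choose (M + i) : ℝ) * A * B := by positivity
    have key : ((N : ℝ) - M - i) * ((M : ℝ) / N) ≤ M * (1 - (M : ℝ) / N) := by
      have : (M : ℝ) * (1 - (M : ℝ) / N) = ((N : ℝ) - M) * ((M : ℝ) / N) := by field_simp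
      rw [this]
      exact mul_le_mul_of_nonneg_right (sub_le_self _ (Nat.cast_nonneg i)) hp
    calc _ = ((N.choose (M + i + 1) : ℝ) * ((M : ℝ) + i + 1)) * A * B * ((M : ℝ) / N) := by ring
      _ = ((N.choose (M + i) : ℝ) * A * B) * (((N : ℝ) - M - i) * ((M : ℝ) / N)) := by
        rw [hc]; ring
      _ ≤ ((N.choose (M + i) : ℝ) * A * B) * (M * (1 - (M : ℝ) / N)) := by gcongr
      _ = _ := by ring
  · rw [Nat.choose_eq_zero_of_lt (by omega : N < M + i + 1)]
    simp only [Nat.cast_zero, zero_mul, mul_zero]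
    positivity

lemma binomial_weight_mul_prod_le {N M : ℕ} (hMN : M < N) (j : ℕ) :
    (∏ i ∈ range j, ((M : ℝ) + i + 1)) * ((N.choose (M + j) : ℝ) * ((M : ℝ) / N) ^ (M + j) *
        (1 - (M : ℝ) / N) ^ (N - (M + j))) ≤
      (M : ℝ) ^ j * ((N.choose M : ℝ) * ((M : ℝ) / N) ^ M * (1 - (M : ℝ) / N) ^ (N - M)) := by
  induction j with
  | zero => simp
  | succ j ih =>
    rw [prod_range_succ, mul_assoc, ← add_assoc]
    refine (mul_le_mul_of_nonneg_left (binomial_weight_succ_le hMN j)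
      (prod_nonneg fun i _ => by positivity)).trans ?_
    rw [mul_left_comm, pow_succ', mul_assoc (M : ℝ) ((M : ℝ) ^ j)]
    exact mul_le_mul_of_nonneg_left ih (Nat.cast_nonneg M)

/-- Pairing the factors `M + i + 1` and `M + 2 * m - i` bounds their product from below. -/
lemma three_pow_mul_pow_le_prod {M m : ℕ} (h : M ≤ m) :
    (3 : ℝ) ^ m * (M : ℝ) ^ (2 * m) ≤ ∏ i ∈ range (2 * m), ((M : ℝ) + i + 1) := by
  refine (sq_le_sq₀ (by positivity) (prod_nonneg fun i _ => by positivity)).1 ?_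
  have hl : ((3 : ℝ) ^ m * (M : ℝ) ^ (2 * m)) ^ 2 = ∏ _i ∈ range (2 * m), (3 * (M : ℝ) ^ 2) := by
    rw [prod_const, card_range, mul_pow, mul_pow, ← pow_mul, ← pow_mul, ← pow_mul, mul_comm m 2,
      mul_comm (2 * m) 2]
  rw [hl, sq (∏ i ∈ range (2 * m), ((M : ℝ) + i + 1))]
  nth_rewrite 2 [← prod_range_reflect (fun i : ℕ => (M : ℝ) + i + 1)]
  rw [← prod_mul_distrib]
  refine prod_le_prod (fun i _ => by positivity) fun i hi => ?_
  have hi' : i + 1 ≤ 2 * m := by simpa [Nat.succ_le_iff] using hi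
  have hcast : ((2 * m - 1 - i : ℕ) : ℝ) = 2 * m - 1 - i := by
    rw [Nat.sub_sub, Nat.cast_sub (by omega)]; push_cast; ring
  have h1 : (i : ℝ) + 1 ≤ 2 * m := by exact_mod_cast hi'
  have h2 : (M : ℝ) ≤ m := by exact_mod_cast h
  have h3 : (0 : ℝ) ≤ M := Nat.cast_nonneg M
  rw [hcast]
  nlinarith [mul_nonneg (by positivity : (0 : ℝ) ≤ (i : ℝ) + 1) (sub_nonneg.2 h1),
    mul_nonneg h3 (sub_nonneg.2 h2), (Nat.cast_nonneg i : (0 : ℝ) ≤ i)]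

lemma binomial_weight_add_two_mul_le {N M m : ℕ} (hM : 1 ≤ M) (hMN : M < N) (h : M ≤ m) :
    (N.choose (M + 2 * m) : ℝ) * ((M : ℝ) / N) ^ (M + 2 * m) *
        (1 - (M : ℝ) / N) ^ (N - (M + 2 * m)) ≤
      (N.choose M : ℝ) * ((M : ℝ) / N) ^ M * (1 - (M : ℝ) / N) ^ (N - M) * (1 / 3) ^ m := by
  have hMN' : (M : ℝ) < N := by exact_mod_cast hMN
  have hM' : (0 : ℝ) < M := by exact_mod_cast hM
  have hq : (0 : ℝ) < 1 - (M : ℝ) / N := by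
    rw [sub_pos, div_lt_one (hM'.trans hMN')]; exact hMN'
  have hb := binomial_weight_mul_prod_le hMN (2 * m)
  set b := (N.choose (M + 2 * m) : ℝ) * ((M : ℝ) / N) ^ (M + 2 * m) *
        (1 - (M : ℝ) / N) ^ (N - (M + 2 * m))
  have hb0 : 0 ≤ b := by positivity
  have h3 := (mul_le_mul_of_nonneg_right (three_pow_mul_pow_le_prod h) hb0).trans hb
  rw [one_div, inv_pow, ← div_eq_mul_inv, le_div_iff₀ (by positivity)]
  refine le_of_mul_le_mul_left ?_ (pow_pos hM' (2 * m))
  linarith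

theorem dicke_overlap_lower_bound
    (N M ℓ : ℕ) (hM : 1 ≤ M) (hMN : M < N) (hℓ : 1 ≤ ℓ)
    (h2ℓ : (2 : ℝ) ^ ℓ ≥ 4 * M)
    (p : ℝ) (hp : p = (M : ℝ) / N) :
    (N.choose M : ℝ) * p ^ M * (1 - p) ^ (N - M) /
        (∑ e ∈ Finset.range (N + 1),
          if e % 2 ^ ℓ = M % 2 ^ ℓ then
            (N.choose e : ℝ) * p ^ e * (1 - p) ^ (N - e) else 0) ≥
      1 - Real.sqrt (8 * π * M) * Real.exp (-(2 : ℝ) ^ (ℓ - 1)) := by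
  subst hp
  have hMN' : (M : ℝ) < N := by exact_mod_cast hMN
  have hM' : (1 : ℝ) ≤ M := by exact_mod_cast hM
  have hN : (0 : ℝ) < N := by linarith
  have hq : (0 : ℝ) < 1 - (M : ℝ) / N := by
    rw [sub_pos, div_lt_one hN]; exact hMN'
  obtain ⟨k, rfl⟩ : ∃ k, ℓ = k + 1 := ⟨ℓ - 1, by omega⟩
  rw [Nat.add_sub_cancel]
  have hL : 4 * M ≤ 2 ^ (k + 1) := by exact_mod_cast h2ℓ
  have hH : 2 ^ (k + 1) = 2 * 2 ^ k := pow_succ' 2 k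
  rw [hH] at hL ⊢
  have hcast : (2 : ℝ) ^ k = ((2 ^ k : ℕ) : ℝ) := by push_cast; rfl
  rw [hcast]
  generalize 2 ^ k = H at hL
  set b : ℕ → ℝ := fun e => (N.choose e : ℝ) * ((M : ℝ) / N) ^ e * (1 - (M : ℝ) / N) ^ (N - e)
    with hb
  have hb0 : ∀ e, 0 ≤ b e := fun e => by simp only [hb]; positivity
  have hbM : 0 < b M := by
    have : 0 < N.choose M := Nat.choose_pos hMN.le
    simp only [hb]; positivity
  set r : ℝ := (1 / 3) ^ H with hr
  have hr0 : 0 ≤ r := by positivity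
  have hr1 : r < 1 := pow_lt_one₀ (by norm_num) (by norm_num) (by omega)
  change b M / (∑ e ∈ range (N + 1), if e % (2 * H) = M % (2 * H) then b e else 0) ≥ _
  set S := ∑ e ∈ range (N + 1), if e % (2 * H) = M % (2 * H) then b e else 0 with hS
  have hSpos : 0 < S := by
    refine hbM.trans_le ?_
    have := single_le_sum (f := fun e => if e % (2 * H) = M % (2 * H) then b e else 0)
      (fun e _ => by split_ifs; exacts [hb0 e, le_rfl])
      (mem_range.2 (by omega : M < N + 1))
    simpa using this
  have hterm : ∀ j, b (M + 2 * H * j) ≤ b M * r ^ j := by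
    intro j
    rcases Nat.eq_zero_or_pos j with rfl | hj
    · simp
    · have hle : M ≤ H * j := by nlinarith
      have := binomial_weight_add_two_mul_le hM hMN hle
      rw [hr, ← pow_mul, mul_assoc 2 H j]
      exact this
  have hSle : S ≤ ∑ j ∈ range (N + 1), b (M + 2 * H * j) := by
    have hinj : Set.InjOn (fun j => M + 2 * H * j) (range (N + 1)) := by
      intro x _ y _ hxy
      have h2H : 0 < 2 * H := by omega
      exact Nat.eq_of_mul_eq_mul_left h2H (Nat.add_left_cancel hxy)
    rw [hS, ← sum_filter, ← sum_image (f := b) hinj]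
    refine sum_le_sum_of_subset_of_nonneg ?_ fun e _ _ => hb0 e
    intro e he
    obtain ⟨heN, hmod⟩ := mem_filter.1 he
    have heN' := mem_range.1 heN
    have hMmod : M % (2 * H) = M := Nat.mod_eq_of_lt (by omega)
    refine mem_image.2 ⟨e / (2 * H), mem_range.2 ((Nat.div_le_self _ _).trans_lt heN'), ?_⟩
    have := Nat.mod_add_div e (2 * H)
    rw [hmod, hMmod] at this
    exact this
  have hgeom : S * (1 - r) ≤ b M := by
    have h1 : S ≤ b M * ∑ j ∈ range (N + 1), r ^ j := by
      rw [mul_sum]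
      exact hSle.trans (sum_le_sum fun j _ => hterm j)
    have h2 : (∑ j ∈ range (N + 1), r ^ j) * (1 - r) ≤ 1 := by
      rw [geom_sum_mul_neg]
      linarith [pow_nonneg hr0 (N + 1)]
    calc S * (1 - r) ≤ (b M * ∑ j ∈ range (N + 1), r ^ j) * (1 - r) :=
          mul_le_mul_of_nonneg_right h1 (by linarith)
      _ = b M * ((∑ j ∈ range (N + 1), r ^ j) * (1 - r)) := by ring
      _ ≤ b M * 1 := mul_le_mul_of_nonneg_left h2 hbM.le
      _ = b M := mul_one _
  have hrexp : r ≤ Real.exp (-(H : ℝ)) := by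
    have h3 : (1 / 3 : ℝ) ≤ Real.exp (-1) := by
      rw [Real.exp_neg, one_div]
      exact inv_anti₀ (Real.exp_pos 1) (by linarith [Real.exp_one_lt_d9])
    calc r ≤ Real.exp (-1) ^ H := pow_le_pow_left₀ (by norm_num) h3 H
      _ = Real.exp (-(H : ℝ)) := by rw [← Real.exp_nat_mul]; ring_nf
  have hsqrt : 1 ≤ Real.sqrt (8 * π * M) := by
    rw [Real.one_le_sqrt]
    nlinarith [Real.pi_gt_three]
  have hfin : r ≤ Real.sqrt (8 * π * M) * Real.exp (-(H : ℝ)) :=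
    hrexp.trans (le_mul_of_one_le_left (Real.exp_pos _).le hsqrt)
  rw [ge_iff_le, le_div_iff₀ hSpos]
  exact (mul_le_mul_of_nonneg_right (by linarith) hSpos.le).trans ((mul_comm _ _).trans_le hgeom)
end

section
/- For all integers M ≥ 1 and N ≥ 4M, setting p = M/N, one has C(N,M)·p^M·(1-p)^(N-M) ≤ √(8/(3πM)). -/
open Real

theorem factorial_eq_stirlingSeq_mul {n : ℕ} (hn : n ≠ 0) :
    (n.factorial : ℝ) = Stirling.stirlingSeq n * (√(2 * n) * (n / exp 1) ^ n) := by
  have : (0 : ℝ) < n := by positivity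
  rw [Stirling.stirlingSeq, div_mul_cancel₀]
  positivity

theorem choose_mul_pow_mul_pow_eq_stirlingSeq {m k : ℕ} (hm : m ≠ 0) (hk : k ≠ 0) :
    ((m + k).choose m : ℝ) * ((m : ℝ) / (m + k)) ^ m * ((k : ℝ) / (m + k)) ^ k =
      Stirling.stirlingSeq (m + k) / (Stirling.stirlingSeq m * Stirling.stirlingSeq k) *
        (√(2 * (m + k)) / (√(2 * m) * √(2 * k))) := by
  have hm' : (0 : ℝ) < m := by positivity
  have hk' : (0 : ℝ) < k := by positivity
  have sm := (sqrt_pos.2 pi_pos).trans_le (Stirling.sqrt_pi_le_stirlingSeq hm)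
  have sk := (sqrt_pos.2 pi_pos).trans_le (Stirling.sqrt_pi_le_stirlingSeq hk)
  rw [Nat.cast_add_choose, factorial_eq_stirlingSeq_mul hm, factorial_eq_stirlingSeq_mul hk,
    factorial_eq_stirlingSeq_mul (n := m + k) (by lia)]
  push_cast
  simp only [div_pow, pow_add]
  field_simp

theorem binomial_central_prob_upper_bound
    (M N : ℕ) (hM : 1 ≤ M) (hN : 4 * M ≤ N)
    (p : ℝ) (hp : p = (M : ℝ) / N) :
    (N.choose M : ℝ) * p ^ M * (1 - p) ^ (N - M) ≤ Real.sqrt (8 / (3 * π * M)) := by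
  obtain ⟨K, rfl⟩ : ∃ K, N = M + K := ⟨N - M, by lia⟩
  have hM0 : M ≠ 0 := by lia
  have hK0 : K ≠ 0 := by lia
  have hM' : (0 : ℝ) < M := by positivity
  have hK' : (0 : ℝ) < K := by positivity
  have hMK : 3 * (M : ℝ) ≤ K := by
    have : 3 * M ≤ K := by lia
    exact_mod_cast this
  have hq : 1 - p = (K : ℝ) / (M + K) := by
    rw [hp]
    push_cast
    field_simp
    ring
  rw [hq, hp, Nat.add_sub_cancel_left, Nat.cast_add, choose_mul_pow_mul_pow_eq_stirlingSeq hM0 hK0]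
  have sM := Stirling.sqrt_pi_le_stirlingSeq hM0
  have sK := (sqrt_pos.2 pi_pos).trans_le (Stirling.sqrt_pi_le_stirlingSeq hK0)
  have hanti : Stirling.stirlingSeq (M + K) ≤ Stirling.stirlingSeq K := by
    have h := Stirling.stirlingSeq'_antitone (show K - 1 ≤ M + K - 1 by lia)
    simpa [show K - 1 + 1 = K by lia, show M + K - 1 + 1 = M + K by lia] using h
  have hratio : Stirling.stirlingSeq (M + K) /
      (Stirling.stirlingSeq M * Stirling.stirlingSeq K) ≤ 1 / √π := by
    rw [div_le_div_iff₀ (mul_pos ((sqrt_pos.2 pi_pos).trans_le sM) sK) (by positivity), one_mul,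
      mul_comm]
    exact mul_le_mul sM hanti ((sqrt_nonneg π).trans
      (Stirling.sqrt_pi_le_stirlingSeq (by lia))) ((sqrt_nonneg π).trans sM)
  calc _ ≤ 1 / √π * (√(2 * (M + K)) / (√(2 * M) * √(2 * K))) := by gcongr
    _ = √(1 / π * (2 * (M + K) / (2 * M * (2 * K)))) := by
      rw [sqrt_mul (x := 1 / π) (by positivity), sqrt_div zero_le_one,
        sqrt_div (x := 2 * ((M : ℝ) + K)) (by positivity),
        sqrt_mul (x := 2 * (M : ℝ)) (by positivity), sqrt_one]
    _ ≤ _ := by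
      apply sqrt_le_sqrt
      rw [div_mul_div_comm, div_le_div_iff₀ (by positivity) (by positivity)]
      have : 0 ≤ π * M * (K - 3 * M) := mul_nonneg (by positivity) (by linarith)
      have : 0 ≤ π * M * K := by positivity
      have : 0 ≤ π * M * M := by positivity
      nlinarith
end

section
/- Let N be a positive integer, 0 < p < 1, and let t be an integer with N·p ≤ t < N. Then Σ_{e=t}^{N} C(N,e)·p^e·(1-p)^(N-e) ≤ exp(-N·D(t/N ‖ p)), where D(a‖p) = a·ln(a/p) + (1-a)·ln((1-a)/(1-p)). -/
open Real Finset

/-- Change of parameter from `p` to `a ≥ p` in a binomial weight lying in the upper tail. -/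
lemma pow_mul_pow_le_tilted {p a : ℝ} (hp0 : 0 < p) (hpa : p ≤ a) (ha1 : a < 1)
    {N t e : ℕ} (hte : t ≤ e) (heN : e ≤ N) :
    p ^ e * (1 - p) ^ (N - e) ≤
      (p / a) ^ t * ((1 - p) / (1 - a)) ^ (N - t) * (a ^ e * (1 - a) ^ (N - e)) := by
  obtain ⟨k, rfl⟩ := Nat.exists_eq_add_of_le hte
  obtain ⟨m, rfl⟩ := Nat.exists_eq_add_of_le heN
  have ha0 : 0 < a := hp0.trans_le hpa
  have hb : 0 < 1 - a := by linarith
  have hq : 0 < 1 - p := by linarith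
  have hk : p ^ k ≤ (a * ((1 - p) / (1 - a))) ^ k := by
    gcongr
    rw [← mul_div_assoc, le_div_iff₀ hb]
    nlinarith
  rw [show t + k + m - (t + k) = m by omega, show t + k + m - t = k + m by omega]
  calc p ^ (t + k) * (1 - p) ^ m = p ^ t * (1 - p) ^ m * p ^ k := by ring
    _ ≤ p ^ t * (1 - p) ^ m * (a * ((1 - p) / (1 - a))) ^ k := by gcongr
    _ = _ := by
      simp only [pow_add, mul_pow, div_pow]
      field_simp

lemma binomial_upper_tail_le_tilted {p a : ℝ} (hp0 : 0 < p) (hpa : p ≤ a) (ha1 : a < 1)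
    (N t : ℕ) :
    ∑ e ∈ Finset.Icc t N, (N.choose e : ℝ) * p ^ e * (1 - p) ^ (N - e) ≤
      (p / a) ^ t * ((1 - p) / (1 - a)) ^ (N - t) := by
  have ha0 : 0 < a := hp0.trans_le hpa
  have hb : 0 < 1 - a := by linarith
  have hq : 0 < 1 - p := by linarith
  have hsum : ∑ e ∈ Finset.Icc t N, (N.choose e : ℝ) * (a ^ e * (1 - a) ^ (N - e)) ≤ 1 := by
    calc _ ≤ ∑ e ∈ Finset.range (N + 1), (N.choose e : ℝ) * (a ^ e * (1 - a) ^ (N - e)) := by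
          refine Finset.sum_le_sum_of_subset_of_nonneg (fun e he => ?_) fun _ _ _ => by positivity
          simp only [Finset.mem_Icc, Finset.mem_range] at he ⊢
          omega
      _ = (a + (1 - a)) ^ N := by
          rw [add_pow]
          exact Finset.sum_congr rfl fun _ _ => mul_comm _ _
      _ = 1 := by simp
  calc _ ≤ ∑ e ∈ Finset.Icc t N, (p / a) ^ t * ((1 - p) / (1 - a)) ^ (N - t) *
          ((N.choose e : ℝ) * (a ^ e * (1 - a) ^ (N - e))) := by
        refine Finset.sum_le_sum fun e he => ?_
        obtain ⟨hte, heN⟩ := Finset.mem_Icc.1 he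
        rw [mul_assoc, mul_left_comm _ (N.choose e : ℝ)]
        exact mul_le_mul_of_nonneg_left (pow_mul_pow_le_tilted hp0 hpa ha1 hte heN)
          (Nat.cast_nonneg _)
    _ ≤ _ := by
        rw [← Finset.mul_sum]
        exact mul_le_of_le_one_right (by positivity) hsum

theorem binomial_chernoff_upper_tail
    (N : ℕ) (hN : 1 ≤ N) (p : ℝ) (hp0 : 0 < p) (hp1 : p < 1)
    (t : ℕ) (ht : (N : ℝ) * p ≤ t) (htN : t < N) :
    (∑ e ∈ Finset.Icc t N, (N.choose e : ℝ) * p ^ e * (1 - p) ^ (N - e)) ≤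
      Real.exp (-(N : ℝ) *
        (((t : ℝ) / N) * Real.log (((t : ℝ) / N) / p) +
          (1 - (t : ℝ) / N) * Real.log ((1 - (t : ℝ) / N) / (1 - p)))) := by
  have hN0 : (0 : ℝ) < N := by exact_mod_cast hN
  have hpa : p ≤ (t : ℝ) / N := by rwa [le_div_iff₀ hN0, mul_comm]
  have ha1 : (t : ℝ) / N < 1 := by
    rw [div_lt_one hN0]
    exact_mod_cast htN
  have hNa : (N : ℝ) * (t / N) = t := mul_div_cancel₀ _ hN0.ne'
  refine (binomial_upper_tail_le_tilted hp0 hpa ha1 N t).trans_eq ?_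
  generalize (t : ℝ) / N = a at *
  have ha0 : 0 < a := hp0.trans_le hpa
  have hb : 0 < 1 - a := by linarith
  have hq : 0 < 1 - p := by linarith
  rw [← Real.exp_log (show 0 < (p / a) ^ t * ((1 - p) / (1 - a)) ^ (N - t) by positivity),
    Real.log_mul (by positivity) (by positivity), Real.log_pow, Real.log_pow,
    Nat.cast_sub htN.le, ← inv_div a p, ← inv_div (1 - a) (1 - p), Real.log_inv, Real.log_inv,
    ← hNa]
  congr 1
  ring
end

section
/- Let M, k be positive reals and let N be a real number with N > M + k. Then N·D((M+k)/N ‖ M/N) ≥ -k + (k+M)·ln((k+M)/M), where D(a‖p) = a·ln(a/p) + (1-a)·ln((1-a)/(1-p)). -/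
open Real

theorem chernoff_exponent_lower_bound
    (M k N : ℝ) (hM : 0 < M) (hk : 0 < k) (hN : N > M + k) :
    N * (((M + k) / N) * Real.log (((M + k) / N) / (M / N)) +
        (1 - (M + k) / N) * Real.log ((1 - (M + k) / N) / (1 - M / N))) ≥
      -k + (k + M) * Real.log ((k + M) / M) := by
  have hN0 : 0 < N := by linarith
  have hb : 0 < N - M - k := by linarith
  have hc : 0 < N - M := by linarith
  have e₁ : (M + k) / N / (M / N) = (k + M) / M := by
    field_simp
    ring
  have e₂ : (1 - (M + k) / N) / (1 - M / N) = (N - M - k) / (N - M) := by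
    rw [one_sub_div hN0.ne', one_sub_div hN0.ne', div_div_div_cancel_right₀ hN0.ne', sub_sub]
  have hlog := mul_le_mul_of_nonneg_left (one_sub_inv_le_log_of_pos (div_pos hb hc)) hb.le
  have hk_eq : (N - M - k) * (1 - ((N - M - k) / (N - M))⁻¹) = -k := by
    rw [inv_div]
    field_simp
    ring
  have hsplit : ∀ x y : ℝ, N * ((M + k) / N * x + (1 - (M + k) / N) * y) =
      (k + M) * x + (N - M - k) * y := by
    intro x y
    field_simp
    ring
  rw [e₁, e₂, hsplit]
  linarith
end

section
/- Fix positive reals M and k. The function f(x) = x·D((M+k)/x ‖ M/x), where D(a‖p) = a·ln(a/p) + (1-a)·ln((1-a)/(1-p)), is strictly decreasing on the interval (M+k, ∞), and f(x) tends to -k + (k+M)·ln((k+M)/M) as x → ∞. -/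
open Real Filter

lemma strictAntiOn_mul_log_div_add {k : ℝ} (hk : 0 < k) :
    StrictAntiOn (fun u : ℝ => u * Real.log (u / (u + k))) (Set.Ioi 0) := by
  have key : ∀ u ∈ Set.Ioi (0 : ℝ), HasDerivAt (fun u : ℝ => u * Real.log (u / (u + k)))
      (Real.log (u / (u + k)) + (1 - u / (u + k))) u := by
    intro u hu
    have hu : 0 < u := hu
    have huk : u + k ≠ 0 := by positivity
    have hdiv := (hasDerivAt_id u).div ((hasDerivAt_id u).add_const k) huk
    have hmul := (hasDerivAt_id u).mul (hdiv.log (div_ne_zero hu.ne' huk))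
    refine hmul.congr_deriv ?_
    simp only [id, Pi.div_apply]
    field_simp
  refine strictAntiOn_of_deriv_neg (convex_Ioi 0)
    (fun u hu => (key u hu).continuousAt.continuousWithinAt) fun u hu => ?_
  rw [interior_Ioi] at hu
  rw [(key u hu).deriv]
  have hu : 0 < u := hu
  have hne : u / (u + k) ≠ 1 := by
    rw [ne_eq, div_eq_one_iff_eq (by positivity)]
    linarith
  linarith [Real.log_lt_sub_one_of_pos (show 0 < u / (u + k) by positivity) hne]

lemma tendsto_mul_log_div_add_atTop (k : ℝ) :
    Tendsto (fun u : ℝ => u * Real.log (u / (u + k))) atTop (nhds (-k)) := by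
  refine (Real.tendsto_mul_log_one_add_div_atTop k).neg.congr' ?_
  filter_upwards [eventually_gt_atTop 0] with u hu
  rw [← inv_div (u + k) u, Real.log_inv, add_div, div_self hu.ne', mul_neg]

lemma mul_binary_relative_entropy_eq {M k x : ℝ} (hM : 0 < M) (hk : 0 < k) (hx : M + k < x) :
    x * (((M + k) / x) * Real.log (((M + k) / x) / (M / x)) +
          (1 - (M + k) / x) * Real.log ((1 - (M + k) / x) / (1 - M / x))) =
      (x - (M + k)) * Real.log ((x - (M + k)) / (x - (M + k) + k)) +
        (k + M) * Real.log ((k + M) / M) := by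
  have hx0 : x ≠ 0 := by linarith
  rw [div_div_div_cancel_right₀ hx0, one_sub_div hx0, one_sub_div hx0,
    div_div_div_cancel_right₀ hx0, show x - (M + k) + k = x - M by ring, add_comm k M]
  field_simp
  ring

theorem chernoff_exponent_antitone_and_limit
    (M k : ℝ) (hM : 0 < M) (hk : 0 < k) :
    StrictAntiOn
        (fun x : ℝ => x * (((M + k) / x) * Real.log (((M + k) / x) / (M / x)) +
          (1 - (M + k) / x) * Real.log ((1 - (M + k) / x) / (1 - M / x))))
        (Set.Ioi (M + k)) ∧
      Filter.Tendsto
        (fun x : ℝ => x * (((M + k) / x) * Real.log (((M + k) / x) / (M / x)) +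
          (1 - (M + k) / x) * Real.log ((1 - (M + k) / x) / (1 - M / x))))
        Filter.atTop (nhds (-k + (k + M) * Real.log ((k + M) / M))) := by
  constructor
  · intro x hx y hy hxy
    simp only [mul_binary_relative_entropy_eq hM hk hx, mul_binary_relative_entropy_eq hM hk hy]
    have h := strictAntiOn_mul_log_div_add hk (Set.mem_Ioi.2 (sub_pos.2 hx))
      (Set.mem_Ioi.2 (sub_pos.2 hy))
      (sub_lt_sub_right hxy (M + k))
    exact add_lt_add_left h _
  · have hsub : Tendsto (fun x : ℝ => x - (M + k)) atTop atTop :=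
      tendsto_atTop_add_const_right _ (-(M + k)) tendsto_id
    refine (((tendsto_mul_log_div_add_atTop k).comp hsub).add_const
      ((k + M) * Real.log ((k + M) / M))).congr' ?_
    filter_upwards [eventually_gt_atTop (M + k)] with x hx
    exact (mul_binary_relative_entropy_eq hM hk hx).symm
end

section
/- Let N ≥ 1 be an integer, let 0 < δ ≤ 1/2 be real, and set p = δ/N. Then Σ_{e odd, 1 ≤ e ≤ N} C(N,e)·p^e·(1-p)^(N-e) ≥ δ/2. -/
open Real Finset

theorem w_state_parity_success_probability
    (N : ℕ) (hN : 1 ≤ N) (δ : ℝ) (hδ0 : 0 < δ) (hδ1 : δ ≤ 1 / 2)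
    (p : ℝ) (hp : p = δ / N) :
    (∑ e ∈ (Finset.range (N + 1)).filter (fun e => Odd e),
        (N.choose e : ℝ) * p ^ e * (1 - p) ^ (N - e)) ≥ δ / 2 := by
  have hN' : (1 : ℝ) ≤ N := by exact_mod_cast hN
  have hNp : (N : ℝ) * p = δ := by
    rw [hp]
    field_simp
  have hp0 : 0 ≤ p := by
    rw [hp]
    positivity
  have hp1 : p ≤ 1 / 2 := by nlinarith
  have bernoulli : 1 - δ ≤ (1 - p) ^ (N - 1) := by
    have h := one_add_mul_le_pow (a := -p) (by linarith) (N - 1)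
    rw [Nat.cast_sub hN, ← sub_eq_add_neg] at h
    push_cast at h
    linarith
  calc δ / 2 ≤ δ * (1 - p) ^ (N - 1) := by nlinarith
    _ = (N.choose 1 : ℝ) * p ^ 1 * (1 - p) ^ (N - 1) := by
      rw [Nat.choose_one_right, pow_one, hNp]
    _ ≤ _ := by
      refine Finset.single_le_sum
        (f := fun e => (N.choose e : ℝ) * p ^ e * (1 - p) ^ (N - e)) (fun e _ => ?_) ?_
      · have : 0 ≤ 1 - p := by linarith
        positivity
      · simp only [Finset.mem_filter, Finset.mem_range]
        exact ⟨by omega, odd_one⟩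
end

section
/- Let N ≥ 8 be an integer, let 0 < δ ≤ 1/2 be real, and set p = δ/N. Then N·p·(1-p)^(N-1) / [Σ_{e odd, 1 ≤ e ≤ N} C(N,e)·p^e·(1-p)^(N-e)] ≥ 1 - δ²/4. -/
open Real Finset

/-- The binomial weight of `k + 1` successes decays at least like `(N p) ^ k / (k + 1)!`,
relative to the weight of a single success. -/
theorem factorial_mul_binomial_weight_le (N : ℕ) (p : ℝ) (hp0 : 0 ≤ p) (hp1 : p ≤ 1)
    (hNp : N * p ≤ 1) (k : ℕ) :
    ((k + 1).factorial : ℝ) * ((N.choose (k + 1) : ℝ) * p ^ (k + 1) * (1 - p) ^ (N - (k + 1))) ≤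
      N * p * (1 - p) ^ (N - 1) * (N * p) ^ k := by
  have hq : 0 ≤ 1 - p := by linarith
  induction k with
  | zero => simp
  | succ k ih =>
    rcases Nat.lt_or_ge N (k + 2) with h | h
    · rw [Nat.choose_eq_zero_of_lt h]
      simp only [Nat.cast_zero, zero_mul, mul_zero]
      positivity
    obtain ⟨m, rfl⟩ := Nat.exists_eq_add_of_le h
    have hch : ((k + 2 + m).choose (k + 2) : ℝ) * (k + 2) =
        ((k + 2 + m).choose (k + 1) : ℝ) * (m + 1) := by
      have h1 := Nat.choose_succ_right_eq (k + 2 + m) (k + 1)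
      rw [show k + 2 + m - (k + 1) = m + 1 by omega] at h1
      exact_mod_cast h1
    rw [show k + 2 + m - (k + 1) = m + 1 by omega] at ih
    rw [show k + 1 + 1 = k + 2 from rfl, show k + 2 + m - (k + 2) = m by omega,
      Nat.factorial_succ (k + 1)]
    push_cast at ih hNp ⊢
    have hstep : (m + 1 : ℝ) * p ≤ (1 - p) * ((k + 2 + m) * p) := by
      have hk : (0 : ℝ) ≤ k * p := by positivity
      nlinarith [mul_nonneg hp0 (sub_nonneg.2 hNp)]
    calc ((k + 1 + 1 : ℝ) * ((k + 1).factorial : ℝ)) *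
          (((k + 2 + m).choose (k + 2) : ℝ) * p ^ (k + 2) * (1 - p) ^ m)
        = ((k + 1).factorial : ℝ) * (((k + 2 + m).choose (k + 2) : ℝ) * (k + 2)) *
            p ^ (k + 2) * (1 - p) ^ m := by ring
      _ = ((k + 1).factorial * ((k + 2 + m).choose (k + 1) : ℝ) * p ^ (k + 1) * (1 - p) ^ m) *
            ((m + 1) * p) := by rw [hch]; ring
      _ ≤ ((k + 1).factorial * ((k + 2 + m).choose (k + 1) : ℝ) * p ^ (k + 1) * (1 - p) ^ m) *
            ((1 - p) * ((k + 2 + m) * p)) := by gcongr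
      _ = ((k + 1).factorial * (((k + 2 + m).choose (k + 1) : ℝ) * p ^ (k + 1) *
            (1 - p) ^ (m + 1))) * ((k + 2 + m) * p) := by ring
      _ ≤ _ := mul_le_mul_of_nonneg_right ih (by positivity)
      _ = _ := by ring

theorem sum_filter_odd_le_sum_range (f : ℕ → ℝ) (hf : ∀ e, 0 ≤ f e) (n : ℕ) :
    ∑ e ∈ (range n).filter (fun e => Odd e), f e ≤ ∑ k ∈ range n, f (2 * k + 1) := by
  rw [← sum_image (g := fun k => 2 * k + 1) (f := f) (fun a _ b _ h => by simpa using h)]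
  refine sum_le_sum_of_subset_of_nonneg ?_ fun e _ _ => hf e
  intro e he
  obtain ⟨he, k, rfl⟩ := mem_filter.1 he
  exact mem_image.2 ⟨k, by simp only [mem_range] at he ⊢; omega, rfl⟩

theorem w_state_parity_fidelity
    (N : ℕ) (hN : 8 ≤ N) (δ : ℝ) (hδ0 : 0 < δ) (hδ1 : δ ≤ 1 / 2)
    (p : ℝ) (hp : p = δ / N) :
    (N : ℝ) * p * (1 - p) ^ (N - 1) /
        (∑ e ∈ (Finset.range (N + 1)).filter (fun e => Odd e),
          (N.choose e : ℝ) * p ^ e * (1 - p) ^ (N - e)) ≥ 1 - δ ^ 2 / 4 := by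
  have hN8 : (8 : ℝ) ≤ N := by exact_mod_cast hN
  have hNp : N * p = δ := by rw [hp]; field_simp
  have hp0 : 0 < p := by rw [hp]; positivity
  have hp1 : p < 1 := by nlinarith
  have hq : 0 < 1 - p := by linarith
  set f : ℕ → ℝ := fun e => (N.choose e : ℝ) * p ^ e * (1 - p) ^ (N - e) with hf
  have hf0 : ∀ e, 0 ≤ f e := fun e => by positivity
  set A : ℝ := N * p * (1 - p) ^ (N - 1) with hA
  have hA0 : 0 < A := by positivity
  have hf1 : f 1 = A := by simp [hf, hA]
  have htail : ∀ k, f (2 * (k + 1) + 1) ≤ A * δ ^ 2 / 6 * (1 / 4) ^ k := by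
    intro k
    have h := factorial_mul_binomial_weight_le N p hp0.le hp1.le (by linarith) (2 * (k + 1))
    rw [← hA, hNp] at h
    have h6 : (6 : ℝ) ≤ ((2 * (k + 1) + 1).factorial : ℝ) := by
      exact_mod_cast Nat.factorial_le (show 3 ≤ 2 * (k + 1) + 1 by omega)
    have hpow : δ ^ (2 * (k + 1)) ≤ δ ^ 2 * (1 / 4) ^ k := by
      rw [pow_mul, pow_succ, mul_comm]
      gcongr
      nlinarith
    have h1 := mul_le_mul_of_nonneg_right h6 (hf0 (2 * (k + 1) + 1))
    have h2 := mul_le_mul_of_nonneg_left hpow hA0.le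
    have h3 : 6 * f (2 * (k + 1) + 1) ≤ A * (δ ^ 2 * (1 / 4) ^ k) := (h1.trans h).trans h2
    linarith
  have hgeom : ∑ k ∈ range N, (1 / 4 : ℝ) ^ k ≤ 4 / 3 := by
    rw [geom_sum_eq (by norm_num), div_le_iff_of_neg (by norm_num)]
    have : (0 : ℝ) ≤ (1 / 4) ^ N := by positivity
    linarith
  have hupper : ∑ e ∈ (range (N + 1)).filter (fun e => Odd e), f e ≤ A * (1 + δ ^ 2 / 4) := by
    refine (sum_filter_odd_le_sum_range f hf0 (N + 1)).trans ?_
    rw [sum_range_succ', mul_zero, zero_add, hf1]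
    have h1 := sum_le_sum fun k (_ : k ∈ range N) => htail k
    rw [← mul_sum] at h1
    have h2 := mul_le_mul_of_nonneg_left hgeom (show 0 ≤ A * δ ^ 2 / 6 by positivity)
    have h3 : 0 ≤ A * δ ^ 2 := by positivity
    linarith
  have hpos : 0 < ∑ e ∈ (range (N + 1)).filter (fun e => Odd e), f e := by
    refine (hf1 ▸ hA0).trans_le (single_le_sum (f := f) (fun e _ => hf0 e) ?_)
    exact mem_filter.2 ⟨mem_range.2 (by omega), odd_one⟩
  rw [ge_iff_le, le_div_iff₀ hpos]
  have h1 := mul_le_mul_of_nonneg_left hupper (show 0 ≤ 1 - δ ^ 2 / 4 by nlinarith)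
  have h2 : 0 ≤ A * (δ ^ 2 / 4) ^ 2 := by positivity
  linarith
end

section
/- Let M, N be integers with 1 ≤ M < N, set p = M/N, and let α = arcsin(√(C(N,M)·p^M·(1-p)^(N-M))). Then π/(4α) + 1/2 ≤ (π/2)·(8πM)^(1/4). -/
open Real

theorem factorial_le_exp_one_mul_sqrt_mul_pow {n : ℕ} (hn : 1 ≤ n) :
    (n.factorial : ℝ) ≤ exp 1 * √n * (n / exp 1) ^ n := by
  have h : Stirling.stirlingSeq n ≤ exp 1 / √2 := by
    have := Stirling.stirlingSeq'_antitone (Nat.zero_le (n - 1))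
    simpa [Nat.sub_add_cancel hn, Stirling.stirlingSeq_one] using this
  have hn' : (0 : ℝ) < n := by exact_mod_cast hn
  rw [Stirling.stirlingSeq, div_le_iff₀ (by positivity)] at h
  refine h.trans_eq ?_
  rw [Real.sqrt_mul zero_le_two]
  field_simp

theorem one_div_four_le_binomial_mode_mul_sqrt {M K : ℕ} (hM : 1 ≤ M) (hK : 1 ≤ K) :
    1 / 4 ≤ ((M + K).choose M : ℝ) * ((M : ℝ) / (M + K)) ^ M * ((K : ℝ) / (M + K)) ^ K * √M := by
  have hM' : (0 : ℝ) < M := by exact_mod_cast hM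
  have hK' : (0 : ℝ) < K := by exact_mod_cast hK
  have hfac : ((M + K).choose M : ℝ) * M.factorial * K.factorial = (M + K).factorial := by
    rw [Nat.choose_symm_add]
    exact_mod_cast Nat.add_choose_mul_factorial_mul_factorial M K
  have hlow := Stirling.le_factorial_stirling (M + K)
  have hupM := factorial_le_exp_one_mul_sqrt_mul_pow hM
  have hupK := factorial_le_exp_one_mul_sqrt_mul_pow hK
  have hpow : (((M + K : ℕ) : ℝ) / exp 1) ^ (M + K) * ((M : ℝ) / (M + K)) ^ M *
      ((K : ℝ) / (M + K)) ^ K = (M / exp 1) ^ M * (K / exp 1) ^ K := by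
    push_cast
    simp only [div_pow, pow_add]
    field_simp
  set C : ℝ := ((M + K).choose M : ℝ)
  set a : ℝ := ((M : ℝ) / (M + K)) ^ M
  set b : ℝ := ((K : ℝ) / (M + K)) ^ K
  set F : ℝ := ((M : ℝ) / exp 1) ^ M
  set G : ℝ := ((K : ℝ) / exp 1) ^ K
  have hapos : 0 < a := by positivity
  have hbpos : 0 < b := by positivity
  have hFpos : 0 < F := by positivity
  have hGpos : 0 < G := by positivity
  have hsqrt : 5 / 2 * √K ≤ √(2 * π * (M + K : ℕ)) := by
    apply Real.le_sqrt_of_sq_le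
    rw [mul_pow, Real.sq_sqrt hK'.le]
    push_cast
    nlinarith [Real.pi_gt_d2]
  have hle : 5 / 2 * √K * (F * G) ≤ C * (exp 1 * √M * F) * (exp 1 * √K * G) * (a * b) := by
    calc 5 / 2 * √K * (F * G) ≤ √(2 * π * (M + K : ℕ)) * (F * G) := by gcongr
      _ = √(2 * π * (M + K : ℕ)) * (((M + K : ℕ) : ℝ) / exp 1) ^ (M + K) * (a * b) := by
        rw [← hpow]; ring
      _ ≤ (M + K).factorial * (a * b) := by gcongr
      _ = C * M.factorial * K.factorial * (a * b) := by rw [hfac]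
      _ ≤ _ := by gcongr
  have hmain : 5 / 2 ≤ C * a * b * √M * exp 1 ^ 2 := by
    have hpos : 0 < √(K : ℝ) * (F * G) := by positivity
    refine le_of_mul_le_mul_right ?_ hpos
    linarith
  have he : exp 1 ^ 2 ≤ 10 := by nlinarith [Real.exp_one_lt_d9, Real.exp_pos 1]
  have hnonneg : 0 ≤ C * a * b * √M := by positivity
  nlinarith

theorem self_le_arcsin {x : ℝ} (h₀ : 0 ≤ x) (h₁ : x ≤ 1) : x ≤ arcsin x := by
  conv_lhs => rw [← Real.sin_arcsin (by linarith) h₁]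
  exact Real.sin_le (Real.arcsin_nonneg.2 h₀)

theorem grover_iteration_count_bound
    (M N : ℕ) (hM : 1 ≤ M) (hMN : M < N)
    (p : ℝ) (hp : p = (M : ℝ) / N)
    (α : ℝ)
    (hα : α = Real.arcsin (Real.sqrt ((N.choose M : ℝ) * p ^ M * (1 - p) ^ (N - M)))) :
    π / (4 * α) + 1 / 2 ≤ (π / 2) * (8 * π * M) ^ ((1 : ℝ) / 4) := by
  obtain ⟨K, rfl⟩ := Nat.exists_eq_add_of_lt hMN
  rw [add_assoc] at hp hα
  have hM' : (1 : ℝ) ≤ M := by exact_mod_cast hM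
  have hp' : 1 - p = ((K + 1 : ℕ) : ℝ) / (M + (K + 1 : ℕ)) := by
    rw [hp]; push_cast; field_simp; ring
  have hpp : p = (M : ℝ) / (M + (K + 1 : ℕ)) := by rw [hp]; push_cast; rfl
  have hq := one_div_four_le_binomial_mode_mul_sqrt hM (Nat.le_add_left 1 K)
  rw [← hpp, ← hp'] at hq
  rw [Nat.add_sub_cancel_left] at hα
  have hp0 : 0 ≤ p := by rw [hpp]; positivity
  have hp1 : 0 ≤ 1 - p := by rw [hp']; positivity
  have hq1 : ((M + (K + 1)).choose M : ℝ) * p ^ M * (1 - p) ^ (K + 1) ≤ 1 := by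
    have hsum := add_pow p (1 - p) (M + (K + 1))
    rw [add_sub_cancel, one_pow] at hsum
    refine le_of_le_of_eq ?_ hsum.symm
    refine le_of_eq_of_le ?_ (Finset.single_le_sum (fun i _ => by positivity)
      (Finset.mem_range.2 (show M < M + (K + 1) + 1 by omega)))
    rw [Nat.add_sub_cancel_left]
    ring
  set q : ℝ := ((M + (K + 1)).choose M : ℝ) * p ^ M * (1 - p) ^ (K + 1)
  set t : ℝ := (M : ℝ) ^ ((1 : ℝ) / 4) with ht
  have ht1 : 1 ≤ t := Real.one_le_rpow hM' (by norm_num)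
  have ht2 : √(M : ℝ) = t ^ 2 := by
    rw [ht, ← Real.rpow_natCast, ← Real.rpow_mul (by positivity), Real.sqrt_eq_rpow]
    norm_num
  have hα_ge : 1 / (2 * t) ≤ α := by
    rw [hα]
    refine le_trans ?_ (self_le_arcsin (Real.sqrt_nonneg _) (Real.sqrt_le_one.2 hq1))
    apply Real.le_sqrt_of_sq_le
    rw [ht2] at hq
    rw [div_pow, div_le_iff₀ (by positivity)]
    linarith
  have hdiv : π / (4 * α) ≤ π / 2 * t := by
    calc π / (4 * α) ≤ π / (4 * (1 / (2 * t))) := by gcongr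
      _ = π / 2 * t := by field_simp; norm_num
  have hroot : 2 * t ≤ (8 * π * M) ^ ((1 : ℝ) / 4) := by
    rw [Real.mul_rpow (by positivity) (by positivity)]
    gcongr
    calc (2 : ℝ) = ((2 : ℝ) ^ (4 : ℝ)) ^ ((1 : ℝ) / 4) := by
          rw [← Real.rpow_mul zero_le_two]; norm_num
      _ ≤ _ := by
          gcongr
          norm_num
          linarith [Real.pi_gt_three]
  nlinarith [Real.pi_gt_three]
end

section
/- Let M, N, s be integers with M ≥ 1, N ≥ 4M, and 3M ≤ s ≤ N, and set p = M/N. Define c̄_s = √(s!·(N-s)!/(M!·(N-M)!)) · Σ_{e=0}^{M} C(M,e)·C(N-M, s-e)·p^{(M+s-2e)/2}·(1-p)^{(N-M-s+2e)/2} (with C(n,k) = 0 for k > n, and real powers of p and 1-p). Then c̄_s² ≤ (2e²/(πM))·e^{9M}·(2M)^{2M}·(3/4)^s. -/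
open Real Finset Nat

theorem choose_sub_sub_mul_pow_le {n k : ℕ} (hk : k ≤ n) (e : ℕ) (he : e ≤ k) :
    (n - e).choose (k - e) * n ^ e ≤ n.choose k * k ^ e := by
  induction e with
  | zero => simp
  | succ e ih =>
    obtain ⟨a, rfl⟩ : ∃ a, k = e + 1 + a := ⟨k - (e + 1), by omega⟩
    obtain ⟨b, rfl⟩ : ∃ b, n = e + 1 + a + b := ⟨n - (e + 1 + a), by omega⟩
    have ih := ih (by omega)
    rw [show e + 1 + a + b - e = a + b + 1 by omega, show e + 1 + a - e = a + 1 by omega] at ih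
    rw [show e + 1 + a + b - (e + 1) = a + b by omega, show e + 1 + a - (e + 1) = a by omega]
    have hstep := Nat.add_one_mul_choose_eq (a + b) a
    have hcross : (e + 1 + a + b) * (a + 1) ≤ (e + 1 + a) * (a + b + 1) := by nlinarith
    refine Nat.le_of_mul_le_mul_left (c := a + b + 1) ?_ (by omega)
    calc (a + b + 1) * ((a + b).choose a * (e + 1 + a + b) ^ (e + 1))
        = ((a + b + 1) * (a + b).choose a) * (e + 1 + a + b) ^ e * (e + 1 + a + b) := by ring
      _ = ((a + b + 1).choose (a + 1) * (e + 1 + a + b) ^ e) *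
            ((e + 1 + a + b) * (a + 1)) := by rw [hstep]; ring
      _ ≤ ((e + 1 + a + b).choose (e + 1 + a) * (e + 1 + a) ^ e) *
            ((e + 1 + a) * (a + b + 1)) := Nat.mul_le_mul ih hcross
      _ = _ := by ring

theorem choose_mul_pow_mul_pow_le {x y : ℝ} (hx : 0 ≤ x) (hy : 0 ≤ y) (n k : ℕ) :
    (n.choose k : ℝ) * x ^ k * y ^ (n - k) ≤ (x + y) ^ n := by
  rcases lt_or_ge n k with h | h
  · simp only [Nat.choose_eq_zero_of_lt h, Nat.cast_zero, zero_mul]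
    positivity
  · rw [add_pow]
    have := Finset.single_le_sum (f := fun m => x ^ m * y ^ (n - m) * (n.choose m : ℝ))
      (fun m _ => by positivity) (Finset.mem_range.2 (Nat.lt_succ_of_le h))
    linarith

theorem sum_choose_mul_pow (x : ℝ) (n : ℕ) :
    ∑ e ∈ Finset.range (n + 1), (n.choose e : ℝ) * x ^ e = (x + 1) ^ n := by
  simp [add_pow, mul_comm]

theorem one_add_pow_le_exp {x : ℝ} (hx : 0 ≤ x) (n : ℕ) :
    (x + 1) ^ n ≤ Real.exp (n * x) := by
  rw [Real.exp_nat_mul]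
  exact pow_le_pow_left₀ (by positivity) (Real.add_one_le_exp x) n

theorem rpow_half_sq {x : ℝ} (hx : 0 ≤ x) (y : ℝ) : (x ^ (y / 2)) ^ 2 = x ^ y := by
  rw [← Real.rpow_natCast, ← Real.rpow_mul hx]
  congr 1
  push_cast
  ring

theorem rpow_weight_sq {p : ℝ} (hp : 0 < p) (hp1 : p < 1) {M N s e : ℕ} (hMN : M ≤ N)
    (he : e ≤ s) :
    (p ^ (((M : ℝ) + s - 2 * e) / 2) * (1 - p) ^ (((N : ℝ) - M - s + 2 * e) / 2)) ^ 2 =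
      ((p / (1 - p))⁻¹) ^ e * (p / (1 - p)) ^ (s - e) * (p ^ M * (1 - p) ^ (N - M)) := by
  have hq : 0 < 1 - p := by linarith
  obtain ⟨a, rfl⟩ := Nat.exists_eq_add_of_le he
  obtain ⟨b, rfl⟩ := Nat.exists_eq_add_of_le hMN
  rw [mul_pow, rpow_half_sq hp.le, rpow_half_sq hq.le]
  have h1 : ((M : ℝ) + ((e + a : ℕ) : ℝ) - 2 * e) = ((M + a : ℕ) : ℝ) - (e : ℕ) := by
    push_cast; ring
  have h2 : (((M + b : ℕ) : ℝ) - M - ((e + a : ℕ) : ℝ) + 2 * e) = ((b + e : ℕ) : ℝ) - (a : ℕ) := by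
    push_cast; ring
  rw [h1, h2, Real.rpow_sub hp, Real.rpow_sub hq]
  simp only [Real.rpow_natCast, Nat.add_sub_cancel_left]
  rw [inv_div, div_pow, div_pow, pow_add, pow_add]
  field_simp

theorem factorial_ratio_eq {M N s : ℕ} (hM : M ≤ N) (hs : s ≤ N) :
    (s ! : ℝ) * ((N - s)! : ℝ) / ((M ! : ℝ) * ((N - M)! : ℝ)) =
      (N.choose M : ℝ) / (N.choose s : ℝ) := by
  rw [Nat.cast_choose ℝ hM, Nat.cast_choose ℝ hs]
  have := Nat.factorial_pos N
  field_simp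

theorem sum_choose_mul_choose_div_mul_pow_le {M N s : ℕ} (hM : 1 ≤ M) (hMs : M ≤ s)
    (hsN : s ≤ N) {q : ℝ} (hq : 0 < q) (hNq : (M : ℝ) ≤ N * q) :
    ∑ e ∈ Finset.range (M + 1),
        (M.choose e : ℝ) * ((N - M).choose (s - e) : ℝ) * q⁻¹ ^ e ≤
      (N.choose s : ℝ) * 3 ^ s := by
  have hM0 : (0 : ℝ) < M := by exact_mod_cast hM
  have hN0 : (0 : ℝ) < N := by exact_mod_cast (by omega : 0 < N)
  calc ∑ e ∈ Finset.range (M + 1),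
        (M.choose e : ℝ) * ((N - M).choose (s - e) : ℝ) * q⁻¹ ^ e
      ≤ ∑ e ∈ Finset.range (M + 1),
          (N.choose s : ℝ) * ((M.choose e : ℝ) * ((s : ℝ) / (N * q)) ^ e) := by
        refine Finset.sum_le_sum fun e he => ?_
        have heM : e ≤ M := Nat.lt_succ_iff.1 (Finset.mem_range.1 he)
        have h1 : (N - M).choose (s - e) * N ^ e ≤ N.choose s * s ^ e :=
          (Nat.mul_le_mul_right _ (Nat.choose_le_choose _ (by omega))).trans
            (choose_sub_sub_mul_pow_le hsN e (by omega))
        have h2 : ((N - M).choose (s - e) : ℝ) * (N : ℝ) ^ e ≤ (N.choose s : ℝ) * (s : ℝ) ^ e := by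
          exact_mod_cast h1
        have h3 : ((N - M).choose (s - e) : ℝ) ≤ (N.choose s : ℝ) * (s : ℝ) ^ e / (N : ℝ) ^ e :=
          (le_div_iff₀ (by positivity)).2 h2
        calc (M.choose e : ℝ) * ((N - M).choose (s - e) : ℝ) * q⁻¹ ^ e
            ≤ (M.choose e : ℝ) * ((N.choose s : ℝ) * (s : ℝ) ^ e / (N : ℝ) ^ e) * q⁻¹ ^ e := by
              gcongr
          _ = _ := by
              rw [div_pow, mul_pow, inv_pow]
              field_simp
    _ = (N.choose s : ℝ) * ((s : ℝ) / (N * q) + 1) ^ M := by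
        rw [← Finset.mul_sum, sum_choose_mul_pow]
    _ ≤ (N.choose s : ℝ) * 3 ^ s := by
        refine mul_le_mul_of_nonneg_left ?_ (by positivity)
        calc ((s : ℝ) / (N * q) + 1) ^ M ≤ ((s : ℝ) / M + 1) ^ M := by gcongr
          _ ≤ Real.exp (M * ((s : ℝ) / M)) := one_add_pow_le_exp (by positivity) M
          _ = Real.exp 1 ^ s := by
              rw [mul_div_cancel₀ _ hM0.ne', ← Real.exp_nat_mul, mul_one]
          _ ≤ 3 ^ s := by
              have := Real.exp_one_lt_d9
              gcongr
              linarith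

theorem sum_choose_mul_choose_mul_pow_le {M N s : ℕ} (hMN : M ≤ N) (hMs : M ≤ s)
    {q : ℝ} (hq : 0 < q) (hNq : ((N : ℝ) - M) * q = M) :
    ∑ e ∈ Finset.range (M + 1),
        (M.choose e : ℝ) * ((N - M).choose (s - e) : ℝ) * q ^ (s - e) ≤
      5 ^ M * Real.exp (4 * M) / 4 ^ s := by
  rw [le_div_iff₀ (by positivity), Finset.sum_mul]
  calc ∑ e ∈ Finset.range (M + 1),
        (M.choose e : ℝ) * ((N - M).choose (s - e) : ℝ) * q ^ (s - e) * 4 ^ s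
      ≤ ∑ e ∈ Finset.range (M + 1), ((M.choose e : ℝ) * 4 ^ e) * Real.exp (4 * M) := by
        refine Finset.sum_le_sum fun e he => ?_
        have heM : e ≤ M := Nat.lt_succ_iff.1 (Finset.mem_range.1 he)
        have h1 : ((N - M).choose (s - e) : ℝ) * (4 * q) ^ (s - e) ≤ Real.exp (4 * M) := by
          calc ((N - M).choose (s - e) : ℝ) * (4 * q) ^ (s - e)
              ≤ (4 * q + 1) ^ (N - M) := by
                simpa using choose_mul_pow_mul_pow_le (x := 4 * q) (y := 1) (by positivity)
                  zero_le_one (N - M) (s - e)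
            _ ≤ Real.exp ((N - M : ℕ) * (4 * q)) := one_add_pow_le_exp (by positivity) _
            _ = Real.exp (4 * M) := by
                rw [Nat.cast_sub hMN]
                congr 1
                linear_combination 4 * hNq
        calc (M.choose e : ℝ) * ((N - M).choose (s - e) : ℝ) * q ^ (s - e) * 4 ^ s
            = (M.choose e : ℝ) * 4 ^ e *
                (((N - M).choose (s - e) : ℝ) * (4 * q) ^ (s - e)) := by
              rw [mul_pow, show (4 : ℝ) ^ s = 4 ^ e * 4 ^ (s - e) by
                rw [← pow_add]; congr 1; omega]
              ring
          _ ≤ _ := by gcongr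
    _ = 5 ^ M * Real.exp (4 * M) := by
        rw [← Finset.sum_mul, sum_choose_mul_pow]
        norm_num

theorem five_pow_mul_exp_le {M : ℕ} (hM : 1 ≤ M) :
    5 ^ M * Real.exp (4 * M) ≤
      (2 * Real.exp 1 ^ 2 / (π * M)) * Real.exp (9 * M) * (2 * M : ℝ) ^ (2 * M) := by
  have hM1 : (1 : ℝ) ≤ M := by exact_mod_cast hM
  have h5 : (5 : ℝ) ^ M * Real.exp (4 * M) ≤ Real.exp (9 * M) := by
    have h : (5 : ℝ) ^ M ≤ Real.exp (M * 5) := by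
      rw [Real.exp_nat_mul]
      gcongr
      linarith [Real.add_one_le_exp (5 : ℝ)]
    calc (5 : ℝ) ^ M * Real.exp (4 * M) ≤ Real.exp (M * 5) * Real.exp (4 * M) := by gcongr
      _ = Real.exp (9 * M) := by rw [← Real.exp_add]; congr 1; ring
  have hpow : (M : ℝ) ≤ (2 * M : ℝ) ^ (2 * M) :=
    (by linarith : (M : ℝ) ≤ 2 * M).trans (le_self_pow₀ (by linarith) (by omega))
  have hpi : π ≤ 2 * Real.exp 1 ^ 2 := by
    nlinarith [Real.pi_le_four, Real.add_one_le_exp (1 : ℝ)]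
  have hconst : 1 ≤ (2 * Real.exp 1 ^ 2 / (π * M)) * (2 * M : ℝ) ^ (2 * M) := by
    rw [div_mul_eq_mul_div, one_le_div (by positivity)]
    gcongr
  calc 5 ^ M * Real.exp (4 * M) ≤ 1 * Real.exp (9 * M) := by rwa [one_mul]
    _ ≤ ((2 * Real.exp 1 ^ 2 / (π * M)) * (2 * M : ℝ) ^ (2 * M)) * Real.exp (9 * M) := by gcongr
    _ = _ := by ring

theorem rotated_dicke_coefficient_bound
    (M N s : ℕ) (hM : 1 ≤ M) (hN : 4 * M ≤ N) (hs : 3 * M ≤ s) (hsN : s ≤ N)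
    (p : ℝ) (hp : p = (M : ℝ) / N)
    (c : ℝ)
    (hc : c = Real.sqrt ((s ! : ℝ) * ((N - s)! : ℝ) / ((M ! : ℝ) * ((N - M)! : ℝ))) *
        ∑ e ∈ Finset.range (M + 1),
          (M.choose e : ℝ) * ((N - M).choose (s - e) : ℝ) *
            p ^ (((M : ℝ) + s - 2 * e) / 2) *
            (1 - p) ^ (((N : ℝ) - M - s + 2 * e) / 2)) :
    c ^ 2 ≤ (2 * Real.exp 1 ^ 2 / (π * M)) * Real.exp (9 * M) *
        ((2 * M : ℝ)) ^ (2 * M) * ((3 : ℝ) / 4) ^ s := by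
  have hM0 : (0 : ℝ) < M := by exact_mod_cast hM
  have hMN' : (M : ℝ) < N := by exact_mod_cast (by omega : M < N)
  have hN0 : (0 : ℝ) < N := hM0.trans hMN'
  have hMN : M ≤ N := by omega
  have hMs : M ≤ s := by omega
  have hp0 : 0 < p := hp ▸ div_pos hM0 hN0
  have hp1 : p < 1 := hp ▸ (div_lt_one hN0).2 hMN'
  have h1p : 0 < 1 - p := by linarith
  have hNp : (N : ℝ) * p = M := by rw [hp]; field_simp
  set q : ℝ := p / (1 - p) with hqdef
  have hq : 0 < q := div_pos hp0 h1p
  have hq1 : q * (1 - p) = p := div_mul_cancel₀ _ h1p.ne'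
  have hNq : ((N : ℝ) - M) * q = M := by
    calc ((N : ℝ) - M) * q = N * (q * (1 - p)) := by rw [← hNp]; ring
      _ = M := by rw [hq1, hNp]
  have hNq' : (M : ℝ) ≤ N * q := by nlinarith [mul_pos hM0 hq]
  set w : ℝ := p ^ M * (1 - p) ^ (N - M) with hw
  have hw0 : 0 < w := by positivity
  have hmode : (N.choose M : ℝ) * w ≤ 1 := by
    have := choose_mul_pow_mul_pow_le hp0.le h1p.le N M
    rwa [add_sub_cancel, one_pow, mul_assoc] at this
  have hF := sum_choose_mul_choose_div_mul_pow_le hM hMs hsN hq hNq'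
  have hG := sum_choose_mul_choose_mul_pow_le hMN hMs hq hNq
  set F := ∑ e ∈ Finset.range (M + 1),
    (M.choose e : ℝ) * ((N - M).choose (s - e) : ℝ) * q⁻¹ ^ e with hFdef
  set G := ∑ e ∈ Finset.range (M + 1),
    (M.choose e : ℝ) * ((N - M).choose (s - e) : ℝ) * q ^ (s - e) with hGdef
  have hG0 : 0 ≤ G := Finset.sum_nonneg fun e _ => by positivity
  have hCs : (0 : ℝ) < N.choose s := by exact_mod_cast Nat.choose_pos hsN
  have hCS : (∑ e ∈ Finset.range (M + 1),
          (M.choose e : ℝ) * ((N - M).choose (s - e) : ℝ) *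
            p ^ (((M : ℝ) + s - 2 * e) / 2) *
            (1 - p) ^ (((N : ℝ) - M - s + 2 * e) / 2)) ^ 2 ≤ F * (G * w) := by
    have hGw : G * w = ∑ e ∈ Finset.range (M + 1),
        (M.choose e : ℝ) * ((N - M).choose (s - e) : ℝ) * q ^ (s - e) * w := Finset.sum_mul _ _ _
    rw [hGw, hFdef]
    refine Finset.sum_sq_le_sum_mul_sum_of_sq_le_mul _ (fun e _ => by positivity)
      (fun e _ => by positivity) fun e he => le_of_eq ?_
    have heM : e ≤ M := Nat.lt_succ_iff.1 (Finset.mem_range.1 he)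
    rw [mul_assoc, mul_pow, rpow_weight_sq hp0 hp1 hMN (heM.trans hMs)]
    ring
  rw [hc, mul_pow, Real.sq_sqrt (by positivity), factorial_ratio_eq hMN hsN]
  calc (N.choose M : ℝ) / (N.choose s : ℝ) * _
      ≤ (N.choose M : ℝ) / (N.choose s : ℝ) * (F * (G * w)) := by gcongr
    _ ≤ (N.choose M : ℝ) / (N.choose s : ℝ) * (((N.choose s : ℝ) * 3 ^ s) *
          ((5 ^ M * Real.exp (4 * M) / 4 ^ s) * w)) := by gcongr
    _ = ((N.choose M : ℝ) * w) * (5 ^ M * Real.exp (4 * M) * (3 / 4) ^ s) := by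
        rw [div_pow]
        field_simp
    _ ≤ 1 * (5 ^ M * Real.exp (4 * M) * (3 / 4) ^ s) := by gcongr
    _ ≤ _ := by
        rw [one_mul]
        exact mul_le_mul_of_nonneg_right (five_pow_mul_exp_le hM) (by positivity)
end

section
/- Let M, N, s be integers with M ≥ 1, N ≥ 4M, and 3M ≤ s ≤ N, set p = M/N, and for 3M ≤ k ≤ N define c̄_k = √(k!·(N-k)!/(M!·(N-M)!)) · Σ_{e=0}^{M} C(M,e)·C(N-M, k-e)·p^{(M+k-2e)/2}·(1-p)^{(N-M-k+2e)/2} (with C(n,j) = 0 for j > n, and real powers of p and 1-p). Then Σ_{k=s}^{N} c̄_k² ≤ (2e²/(M·π·ln(4/3))) · exp(-(s-1)·ln(4/3) + 2M·(ln(2M) + 9/2)). -/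
open Real Finset Nat

theorem factorial_add_le_pow_mul (j e : ℕ) : (j + e)! ≤ (j + e) ^ e * j ! := by
  have h := Nat.factorial_mul_descFactorial (Nat.le_add_left e j)
  rw [Nat.add_sub_cancel] at h
  rw [← h, mul_comm]
  exact Nat.mul_le_mul_right _ (Nat.descFactorial_le_pow _ _)

/-- The generating function bound for a single binomial probability, evaluated at `4`. -/
theorem choose_mul_pow_le_exp (j m : ℕ) {p : ℝ} (hp0 : 0 ≤ p) (hp1 : p ≤ 1) :
    ((j + m).choose j : ℝ) * p ^ j * (1 - p) ^ m * 4 ^ j ≤ Real.exp (3 * (p * (j + m))) := by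
  have hq : 0 ≤ 1 - p := sub_nonneg.2 hp1
  have h1 : ((j + m).choose j : ℝ) * p ^ j * (1 - p) ^ m * 4 ^ j ≤
      (4 * p + (1 - p)) ^ (j + m) := by
    rw [add_pow]
    refine le_trans (le_of_eq ?_) (Finset.single_le_sum
      (f := fun i => (4 * p) ^ i * (1 - p) ^ (j + m - i) * ((j + m).choose i : ℝ))
      (fun i _ => by positivity) (Finset.mem_range.2 (by omega : j < j + m + 1)))
    simp only [Nat.add_sub_cancel_left, mul_pow]
    ring
  have h2 : (4 * p + (1 - p)) ^ (j + m) ≤ Real.exp (3 * p) ^ (j + m) :=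
    pow_le_pow_left₀ (by positivity) (by linarith [Real.add_one_le_exp (3 * p)]) _
  refine h1.trans (h2.trans (le_of_eq ?_))
  rw [← Real.exp_nat_mul]
  congr 1
  push_cast
  ring

theorem dicke_weight_sq_le (d e j m : ℕ) {p : ℝ} (hp0 : 0 ≤ p) (hp1 : p ≤ 1)
    (hp : p * (e + d + j + m) = e + d) :
    (((j + e)! : ℝ) * ((m + d)! : ℝ) / (((e + d)! : ℝ) * ((j + m)! : ℝ))) *
        (((j + m).choose j : ℝ) ^ 2 * (p ^ (d + j) * (1 - p) ^ (m + e))) ≤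
      ((j + e : ℕ) : ℝ) ^ e * ((e + d : ℕ) : ℝ) ^ d / ((e + d)! : ℝ) *
        (Real.exp (3 * (e + d)) / 4 ^ j) := by
  have hq : 0 ≤ 1 - p := sub_nonneg.2 hp1
  have hchoose : ((j + m).choose j : ℝ) * ((j ! : ℝ) * (m ! : ℝ)) = ((j + m)! : ℝ) := by
    have := Nat.choose_mul_factorial_mul_factorial (Nat.le_add_right j m)
    rw [Nat.add_sub_cancel_left] at this
    rw [← mul_assoc]
    exact_mod_cast this
  have hj : ((j + e)! : ℝ) / (j ! : ℝ) ≤ ((j + e : ℕ) : ℝ) ^ e := by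
    rw [div_le_iff₀ (by positivity)]
    exact_mod_cast factorial_add_le_pow_mul j e
  have hm : ((m + d)! : ℝ) / (m ! : ℝ) ≤ ((m + d : ℕ) : ℝ) ^ d := by
    rw [div_le_iff₀ (by positivity)]
    exact_mod_cast factorial_add_le_pow_mul m d
  have hmd : ((m + d)! : ℝ) / (m ! : ℝ) * p ^ d ≤ ((e + d : ℕ) : ℝ) ^ d := by
    refine (mul_le_mul_of_nonneg_right hm (by positivity)).trans ?_
    rw [← mul_pow]
    refine pow_le_pow_left₀ (by positivity) ?_ _
    push_cast
    have : 0 ≤ p * ((e : ℝ) + j) := by positivity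
    nlinarith
  have hb : ((j + m).choose j : ℝ) * p ^ j * (1 - p) ^ m ≤ Real.exp (3 * (e + d)) / 4 ^ j := by
    rw [le_div_iff₀ (by positivity)]
    refine (choose_mul_pow_le_exp j m hp0 hp1).trans (Real.exp_le_exp.2 ?_)
    have : 0 ≤ p * ((e : ℝ) + d) := by positivity
    nlinarith
  have hqe : (1 - p) ^ e ≤ 1 := pow_le_one₀ hq (by linarith)
  have hC : (0 : ℝ) < ((j + m).choose j : ℝ) := by
    exact_mod_cast Nat.choose_pos (Nat.le_add_right j m)
  calc _ = (((j + e)! : ℝ) / (j ! : ℝ)) * (((m + d)! : ℝ) / (m ! : ℝ) * p ^ d) /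
          ((e + d)! : ℝ) * (((j + m).choose j : ℝ) * p ^ j * (1 - p) ^ m) * (1 - p) ^ e := by
        rw [← hchoose, pow_add, pow_add]
        field_simp
    _ ≤ (((j + e)! : ℝ) / (j ! : ℝ)) * (((m + d)! : ℝ) / (m ! : ℝ) * p ^ d) /
          ((e + d)! : ℝ) * (((j + m).choose j : ℝ) * p ^ j * (1 - p) ^ m) :=
        mul_le_of_le_one_right (by positivity) hqe
    _ ≤ _ := by gcongr

theorem dicke_coefficient_sq_le (M N k : ℕ) (hM : 1 ≤ M) (hN : 4 * M ≤ N) (hk : 3 * M ≤ k)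
    (hkN : k ≤ N) (p : ℝ) (hp : p = (M : ℝ) / N) :
    (Real.sqrt ((k ! : ℝ) * ((N - k)! : ℝ) / ((M ! : ℝ) * ((N - M)! : ℝ))) *
        ∑ e ∈ Finset.range (M + 1),
          (M.choose e : ℝ) * ((N - M).choose (k - e) : ℝ) *
            p ^ (((M : ℝ) + k - 2 * e) / 2) *
            (1 - p) ^ (((N : ℝ) - M - k + 2 * e) / 2)) ^ 2 ≤
      (10 * Real.exp 3) ^ M * (3 / 4) ^ k := by
  have hM' : (1 : ℝ) ≤ M := by exact_mod_cast hM
  have hN' : (4 : ℝ) * M ≤ N := by exact_mod_cast hN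
  have hNpos : (0 : ℝ) < N := by linarith
  have hpN : p * N = M := by rw [hp]; field_simp
  have hp0 : 0 < p := by rw [hp]; positivity
  have hp1 : p < 1 := by rw [hp, div_lt_one hNpos]; linarith
  have hq : 0 < 1 - p := sub_pos.2 hp1
  set F : ℝ := (k ! : ℝ) * ((N - k)! : ℝ) / ((M ! : ℝ) * ((N - M)! : ℝ)) with hF
  have hF0 : 0 ≤ F := by positivity
  set b : ℕ → ℝ := fun e => ((N - M).choose (k - e) : ℝ) *
    (p ^ (((M : ℝ) + k - 2 * e) / 2) * (1 - p) ^ (((N : ℝ) - M - k + 2 * e) / 2)) with hb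
  have hterm : ∀ e ∈ Finset.range (M + 1),
      F * b e ^ 2 ≤ Real.exp (3 * M) / (M ! * 4 ^ k) * ((4 * k) ^ e * (M : ℝ) ^ (M - e)) := by
    intro e he
    have heM : e ≤ M := Nat.lt_succ_iff.1 (Finset.mem_range.1 he)
    by_cases hlarge : N - M < k - e
    · simp only [hb, Nat.choose_eq_zero_of_lt hlarge]
      simp only [Nat.cast_zero, zero_mul]
      rw [zero_pow two_ne_zero, mul_zero]
      positivity
    obtain ⟨d, rfl⟩ := Nat.exists_eq_add_of_le heM
    obtain ⟨j, rfl⟩ := Nat.exists_eq_add_of_le' (show e ≤ k by omega)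
    obtain ⟨m, hm⟩ := Nat.exists_eq_add_of_le (show j ≤ N - (e + d) by omega)
    obtain rfl : N = e + d + j + m := by omega
    have e1 : e + d + j + m - (j + e) = m + d := by omega
    have e2 : j + e - e = j := by omega
    have e3 : e + d - e = d := by omega
    have hbsq : b e ^ 2 = ((j + m).choose j : ℝ) ^ 2 * (p ^ (d + j) * (1 - p) ^ (m + e)) := by
      simp only [hb, hm, e2]
      rw [mul_pow, mul_pow, ← Real.rpow_mul_natCast hp0.le, ← Real.rpow_mul_natCast hq.le,
        ← Real.rpow_natCast p, ← Real.rpow_natCast (1 - p)]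
      congr 3 <;> · push_cast; ring
    have key := dicke_weight_sq_le d e j m hp0.le hp1.le (by exact_mod_cast hpN)
    rw [hbsq, hF, hm, e1, e3]
    refine key.trans (le_of_eq ?_)
    rw [mul_pow, pow_add (4 : ℝ) j e]
    push_cast
    field_simp
  have hCS : (∑ e ∈ Finset.range (M + 1), (M.choose e : ℝ) * b e) ^ 2 ≤
      (∑ e ∈ Finset.range (M + 1), (M.choose e : ℝ)) *
        ∑ e ∈ Finset.range (M + 1), (M.choose e : ℝ) * b e ^ 2 :=
    Finset.sum_sq_le_sum_mul_sum_of_sq_le_mul _ (fun _ _ => by positivity)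
      (fun _ _ => by positivity) (fun _ _ => le_of_eq (by ring))
  have htwo : (∑ e ∈ Finset.range (M + 1), (M.choose e : ℝ)) = 2 ^ M := by
    exact_mod_cast Nat.sum_range_choose M
  have hsum : F * ∑ e ∈ Finset.range (M + 1), (M.choose e : ℝ) * b e ^ 2 ≤
      Real.exp (3 * M) / (M ! * 4 ^ k) * (4 * k + M) ^ M := by
    rw [add_pow, Finset.mul_sum, Finset.mul_sum]
    refine Finset.sum_le_sum fun e he => ?_
    calc F * ((M.choose e : ℝ) * b e ^ 2) = (F * b e ^ 2) * M.choose e := by ring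
      _ ≤ _ := mul_le_mul_of_nonneg_right (hterm e he) (by positivity)
      _ = _ := by ring
  have hk' : (3 : ℝ) * M ≤ k := by exact_mod_cast hk
  have hpow : ((4 : ℝ) * k + M) ^ M ≤ 5 ^ M * (M ! * 3 ^ k) := by
    have h1 : (k : ℝ) ^ M / M ! ≤ Real.exp k := Real.pow_div_factorial_le_exp _ (by positivity) _
    have h2 : Real.exp k ≤ 3 ^ k := by
      rw [← mul_one (k : ℝ), Real.exp_nat_mul]
      exact pow_le_pow_left₀ (by positivity) (by linarith [Real.exp_one_lt_d9]) _
    have h3 : (k : ℝ) ^ M ≤ M ! * 3 ^ k := by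
      rw [mul_comm]
      exact (div_le_iff₀ (by positivity)).1 (h1.trans h2)
    calc ((4 : ℝ) * k + M) ^ M ≤ (5 * k) ^ M :=
          pow_le_pow_left₀ (by positivity) (by linarith) _
      _ = 5 ^ M * (k : ℝ) ^ M := mul_pow _ _ _
      _ ≤ _ := by gcongr
  have hrw : (∑ e ∈ Finset.range (M + 1),
      (M.choose e : ℝ) * ((N - M).choose (k - e) : ℝ) * p ^ (((M : ℝ) + k - 2 * e) / 2) *
        (1 - p) ^ (((N : ℝ) - M - k + 2 * e) / 2)) =
      ∑ e ∈ Finset.range (M + 1), (M.choose e : ℝ) * b e :=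
    Finset.sum_congr rfl fun e _ => by simp only [hb]; ring
  rw [hrw, mul_pow, Real.sq_sqrt hF0]
  calc F * (∑ e ∈ Finset.range (M + 1), (M.choose e : ℝ) * b e) ^ 2
      ≤ F * (2 ^ M * ∑ e ∈ Finset.range (M + 1), (M.choose e : ℝ) * b e ^ 2) := by
        rw [← htwo]
        exact mul_le_mul_of_nonneg_left hCS hF0
    _ = 2 ^ M * (F * ∑ e ∈ Finset.range (M + 1), (M.choose e : ℝ) * b e ^ 2) := by ring
    _ ≤ 2 ^ M * (Real.exp (3 * M) / (M ! * 4 ^ k) * (5 ^ M * (M ! * 3 ^ k))) := by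
        refine mul_le_mul_of_nonneg_left (hsum.trans ?_) (by positivity)
        exact mul_le_mul_of_nonneg_left hpow (by positivity)
    _ = (10 * Real.exp 3) ^ M * (3 / 4) ^ k := by
        rw [mul_comm (3 : ℝ) M, Real.exp_nat_mul, mul_pow, div_pow,
          show (10 : ℝ) = 2 * 5 by norm_num, mul_pow]
        field_simp

theorem sum_Icc_three_quarters_pow_le (s N : ℕ) (h : s ≤ N) :
    ∑ k ∈ Finset.Icc s N, ((3 : ℝ) / 4) ^ k ≤ 4 * (3 / 4) ^ s := by
  have key : ∑ k ∈ Finset.Icc s N, ((3 : ℝ) / 4) ^ k = 4 * ((3 / 4) ^ s - (3 / 4) ^ (N + 1)) := by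
    induction N, h using Nat.le_induction with
    | base => simp; ring
    | succ n hn ih => rw [Finset.sum_Icc_succ_top (by omega), ih]; ring
  rw [key]
  have : (0 : ℝ) ≤ (3 / 4) ^ (N + 1) := by positivity
  linarith

theorem three_quarters_pow_mul_le_exp (M s : ℕ) (hM : 1 ≤ M) :
    (10 * Real.exp 3) ^ M * (4 * ((3 : ℝ) / 4) ^ s) ≤
      (2 * Real.exp 1 ^ 2 / ((M : ℝ) * π * Real.log (4 / 3))) *
        Real.exp (-((s : ℝ) - 1) * Real.log (4 / 3) +
          2 * M * (Real.log (2 * M) + 9 / 2)) := by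
  have hM' : (1 : ℝ) ≤ M := by exact_mod_cast hM
  have hL0 : 0 < Real.log (4 / 3) := Real.log_pos (by norm_num)
  have hL1 : Real.log (4 / 3) ≤ 1 / 3 := by
    linarith [Real.log_le_sub_one_of_pos (show (0 : ℝ) < 4 / 3 by norm_num)]
  have hs : Real.exp (-((s : ℝ) - 1) * Real.log (4 / 3)) = 4 / 3 * (3 / 4) ^ s := by
    rw [show -((s : ℝ) - 1) * Real.log (4 / 3) = Real.log (4 / 3) + s * -Real.log (4 / 3) by ring,
      Real.exp_add, Real.exp_nat_mul, Real.exp_neg, Real.exp_log (by norm_num)]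
    norm_num
  have hMexp : Real.exp (2 * M * (Real.log (2 * M) + 9 / 2)) =
      (4 * (M : ℝ) ^ 2 * Real.exp 9) ^ M := by
    rw [show 2 * (M : ℝ) * (Real.log (2 * M) + 9 / 2) =
        M * (Real.log (2 * M) + Real.log (2 * M) + 9) by ring, Real.exp_nat_mul,
      Real.exp_add, Real.exp_add, Real.exp_log (by positivity)]
    ring
  have hconst : 3 / (M : ℝ) ≤ 2 * Real.exp 1 ^ 2 / ((M : ℝ) * π * Real.log (4 / 3)) := by
    rw [div_le_div_iff₀ (by positivity) (by positivity)]
    have h1 : π * Real.log (4 / 3) ≤ 4 * (1 / 3) :=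
      mul_le_mul Real.pi_le_four hL1 hL0.le (by norm_num)
    have h2 : (2 : ℝ) ≤ Real.exp 1 ^ 2 := by nlinarith [Real.exp_one_gt_d9]
    nlinarith
  have hbase : 10 * Real.exp 3 ≤ 4 * Real.exp 9 := by
    rw [show (9 : ℝ) = 6 + 3 by norm_num, Real.exp_add]
    nlinarith [Real.add_one_le_exp (6 : ℝ), Real.exp_pos 3]
  have hself : (M : ℝ) ≤ ((M : ℝ) ^ 2) ^ M := by
    rw [← pow_mul]
    exact le_self_pow₀ hM' (by omega)
  have hmain : M * (10 * Real.exp 3) ^ M ≤ (4 * (M : ℝ) ^ 2 * Real.exp 9) ^ M := by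
    rw [show 4 * (M : ℝ) ^ 2 * Real.exp 9 = (M : ℝ) ^ 2 * (4 * Real.exp 9) by ring,
      mul_pow _ (4 * Real.exp 9)]
    gcongr
  rw [Real.exp_add, hs, hMexp]
  calc (10 * Real.exp 3) ^ M * (4 * ((3 : ℝ) / 4) ^ s)
      = 3 / (M : ℝ) * (4 / 3 * (3 / 4) ^ s * (M * (10 * Real.exp 3) ^ M)) := by
        field_simp
    _ ≤ _ := by gcongr

theorem rotated_dicke_tail_sum_bound
    (M N s : ℕ) (hM : 1 ≤ M) (hN : 4 * M ≤ N) (hs : 3 * M ≤ s) (hsN : s ≤ N)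
    (p : ℝ) (hp : p = (M : ℝ) / N)
    (c : ℕ → ℝ)
    (hc : ∀ k, 3 * M ≤ k → k ≤ N →
      c k = Real.sqrt ((k ! : ℝ) * ((N - k)! : ℝ) / ((M ! : ℝ) * ((N - M)! : ℝ))) *
        ∑ e ∈ Finset.range (M + 1),
          (M.choose e : ℝ) * ((N - M).choose (k - e) : ℝ) *
            p ^ (((M : ℝ) + k - 2 * e) / 2) *
            (1 - p) ^ (((N : ℝ) - M - k + 2 * e) / 2)) :
    (∑ k ∈ Finset.Icc s N, c k ^ 2) ≤
      (2 * Real.exp 1 ^ 2 / ((M : ℝ) * π * Real.log (4 / 3))) *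
        Real.exp (-((s : ℝ) - 1) * Real.log (4 / 3) +
          2 * M * (Real.log (2 * M) + 9 / 2)) := by
  calc ∑ k ∈ Finset.Icc s N, c k ^ 2
      ≤ ∑ k ∈ Finset.Icc s N, (10 * Real.exp 3) ^ M * (3 / 4) ^ k := by
        refine Finset.sum_le_sum fun k hk => ?_
        obtain ⟨hsk, hkN⟩ := Finset.mem_Icc.1 hk
        rw [hc k (hs.trans hsk) hkN]
        exact dicke_coefficient_sq_le M N k hM hN (hs.trans hsk) hkN p hp
    _ ≤ (10 * Real.exp 3) ^ M * (4 * (3 / 4) ^ s) := by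
        rw [← Finset.mul_sum]
        exact mul_le_mul_of_nonneg_left (sum_Icc_three_quarters_pow_le s N hsN) (by positivity)
    _ ≤ _ := three_quarters_pow_mul_le_exp M s hM
end
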